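/- Let d ∈ ℕ, let b₁,…,b_d ∈ C³([0,1]^d,ℝ) satisfy for all i ∈ {1,…,d} and all x = (x₁,…,x_d) ∈ [0,1]^d with x_i ∈ {0,1} that (−1)^{x_i} b_i(x) ≥ 0, and let y be the associated flow. Assume additionally that for every t ∈ [0,∞) the map x ↦ y(t,x) is twice continuously differentiable on [0,1]^d with all first and second partial derivatives jointly continuous in (t,x). Then for every j, k ∈ {1,…,d}, every t ∈ [0,∞), and every x ∈ [0,1]^d it holds that Σ_{i=1}^d |∂²y_i/(∂x_k ∂x_j)(t,x)| ≤ (1/2)(e^{2λ₂ t} − 1) e^{λ₂ t}. -/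

import Mathlib

open MeasureTheory Filter

noncomputable section

/-- The unit cube `[0,1]^d` in `ℝ^d`. -/
def cube (d : ℕ) : Set (Fin d → ℝ) := Set.univ.pi fun _ => Set.Icc (0:ℝ) 1

/-- Partial derivative in coordinate `i` (within `[0,1]`, i.e. one-sided at the boundary). -/
def pd (d : ℕ) (i : Fin d) (g : (Fin d → ℝ) → ℝ) : (Fin d → ℝ) → ℝ :=
  fun x => derivWithin (fun t => g (Function.update x i t)) (Set.Icc (0:ℝ) 1) (x i)

/-- Iterated partial derivative `∂^α` (coordinates applied in a fixed order). -/
def mderiv (d : ℕ) (α : Fin d → ℕ) (f : (Fin d → ℝ) → ℝ) : (Fin d → ℝ) → ℝ :=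
  List.foldr (fun i g => (pd d i)^[α i] g) f (List.finRange d)

/-- `f ∈ C^m([0,1]^d, ℝ)`: all partial derivatives of order `0` through `m` exist
(one-sidedly at the boundary) and are continuous on the cube. -/
def MemCm (d : ℕ) : ℕ → ((Fin d → ℝ) → ℝ) → Prop
  | 0, f => ContinuousOn f (cube d)
  | m + 1, f => ContinuousOn f (cube d) ∧ ∀ i : Fin d,
      (∀ x ∈ cube d, DifferentiableWithinAt ℝ (fun t => f (Function.update x i t))
        (Set.Icc (0:ℝ) 1) (x i)) ∧
      MemCm d m (pd d i f)

/-- Sup norm over the cube: `‖g‖_∞ = sup_{x ∈ [0,1]^d} |g(x)|`. -/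
def supCube (d : ℕ) (g : (Fin d → ℝ) → ℝ) : ℝ := ⨆ x : cube d, |g x.1|

/-- The `C^m`-norm: `max_{|α| ≤ m} sup_{x ∈ [0,1]^d} |∂^α f(x)|`. -/
def CmNorm (d m : ℕ) (f : (Fin d → ℝ) → ℝ) : ℝ :=
  ⨆ α : {α : Fin d → ℕ // (∑ i, α i) ≤ m}, supCube d (mderiv d α.1 f)

/-- `λ_m := max_{0 < |α| ≤ m} ∑_i ‖∂^α b_i‖_∞`. -/
def lamNorm (d m : ℕ) (b : Fin d → (Fin d → ℝ) → ℝ) : ℝ :=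
  ⨆ α : {α : Fin d → ℕ // 0 < (∑ i, α i) ∧ (∑ i, α i) ≤ m},
    ∑ i, supCube d (mderiv d α.1 (b i))

open Set Function Topology

lemma isCompact_cube (d : ℕ) : IsCompact (cube d) :=
  isCompact_univ_pi fun _ => isCompact_Icc

lemma convex_cube (d : ℕ) : Convex ℝ (cube d) :=
  convex_pi fun _ _ => convex_Icc 0 1

lemma mem_cube {d : ℕ} {x : Fin d → ℝ} : x ∈ cube d ↔ ∀ i, x i ∈ Icc (0 : ℝ) 1 := by
  simp only [cube, mem_univ_pi]

lemma interior_cube (d : ℕ) : interior (cube d) = univ.pi fun _ => Ioo (0 : ℝ) 1 := by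
  rw [cube, interior_pi_set finite_univ]
  simp

lemma mem_interior_cube {d : ℕ} {x : Fin d → ℝ} :
    x ∈ interior (cube d) ↔ ∀ i, x i ∈ Ioo (0 : ℝ) 1 := by
  simp [interior_cube]

lemma closure_interior_cube (d : ℕ) : closure (interior (cube d)) = cube d := by
  rw [interior_cube, closure_pi_set, cube]
  simp

lemma update_mem_cube {d : ℕ} {x : Fin d → ℝ} (hx : x ∈ cube d) (i : Fin d) {r : ℝ}
    (hr : r ∈ Icc (0 : ℝ) 1) : update x i r ∈ cube d := by
  rw [mem_cube] at hx ⊢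
  intro l
  rcases eq_or_ne l i with rfl | h
  · simpa using hr
  · simpa [h] using hx l

lemma update_mem_interior_cube {d : ℕ} {x : Fin d → ℝ} (hx : x ∈ interior (cube d)) (i : Fin d)
    {r : ℝ} (hr : r ∈ Ioo (0 : ℝ) 1) : update x i r ∈ interior (cube d) := by
  rw [mem_interior_cube] at hx ⊢
  intro l
  rcases eq_or_ne l i with rfl | h
  · simpa using hr
  · simpa [h] using hx l

lemma MemCm.continuousOn {d m : ℕ} {f : (Fin d → ℝ) → ℝ} (hf : MemCm d m f) :
    ContinuousOn f (cube d) := by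
  cases m with
  | zero => exact hf
  | succ m => exact hf.1

lemma MemCm.memCm_pd {d m : ℕ} {f : (Fin d → ℝ) → ℝ} (hf : MemCm d (m + 1) f) (i : Fin d) :
    MemCm d m (pd d i f) := (hf.2 i).2

lemma MemCm.of_succ {d m : ℕ} {f : (Fin d → ℝ) → ℝ} (hf : MemCm d (m + 1) f) : MemCm d m f := by
  induction m generalizing f with
  | zero => exact hf.1
  | succ m ih => exact ⟨hf.1, fun i => ⟨(hf.2 i).1, ih (hf.2 i).2⟩⟩

lemma MemCm.hasDerivWithinAt_update {d m : ℕ} {f : (Fin d → ℝ) → ℝ} (hf : MemCm d (m + 1) f)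
    {x : Fin d → ℝ} (hx : x ∈ cube d) (i : Fin d) {r : ℝ} (hr : r ∈ Icc (0 : ℝ) 1) :
    HasDerivWithinAt (fun t => f (update x i t)) (pd d i f (update x i r)) (Icc 0 1) r := by
  have h := ((hf.2 i).1 _ (update_mem_cube hx i hr)).hasDerivWithinAt
  simpa [pd] using h

/-- The differential of `f` on the cube, assembled from the partial derivatives. -/
def cubeGrad (d : ℕ) (f : (Fin d → ℝ) → ℝ) (x : Fin d → ℝ) : (Fin d → ℝ) →L[ℝ] ℝ :=
  ∑ i, pd d i f x • ContinuousLinearMap.proj (R := ℝ) (φ := fun _ : Fin d => ℝ) i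

lemma cubeGrad_apply (d : ℕ) (f : (Fin d → ℝ) → ℝ) (x v : Fin d → ℝ) :
    cubeGrad d f x v = ∑ i, pd d i f x * v i := by
  simp [cubeGrad]

lemma MemCm.hasFDerivWithinAt {d : ℕ} {f : (Fin d → ℝ) → ℝ} (hf : MemCm d 1 f)
    {x : Fin d → ℝ} (hx : x ∈ cube d) :
    HasFDerivWithinAt f (cubeGrad d f x) (cube d) x := by
  rw [hasFDerivWithinAt_iff_isLittleO, Asymptotics.isLittleO_iff]
  intro c hc
  set ε : ℝ := c / (d + 1) with hε
  have hε0 : 0 < ε := by positivity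
  have hev : ∀ᶠ z in 𝓝[cube d] x, ∀ i, |pd d i f z - pd d i f x| < ε := by
    rw [eventually_all]
    intro i
    have := (hf.memCm_pd i).continuousOn x hx
    exact (Metric.continuousWithinAt_iff'.1 this) ε hε0
  obtain ⟨δ, hδ, hδs⟩ := Metric.mem_nhdsWithin_iff.1 hev
  filter_upwards [inter_mem_nhdsWithin (cube d) (Metric.ball_mem_nhds x hδ)] with z hz
  obtain ⟨hzc, hzb⟩ := hz
  have hzi : ∀ i, |z i - x i| < δ := by
    intro i
    have := (dist_pi_lt_iff hδ).1 (Metric.mem_ball.1 hzb) i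
    rwa [Real.dist_eq] at this
  have key : ∀ s : Finset (Fin d),
      |f (s.piecewise z x) - f x - ∑ i ∈ s, pd d i f x * (z i - x i)| ≤
        ∑ i ∈ s, ε * |z i - x i| := by
    intro s
    induction s using Finset.induction_on with
    | empty => simp
    | insert i s his ih =>
      rw [Finset.sum_insert his, Finset.sum_insert his, Finset.piecewise_insert]
      set w := s.piecewise z x with hw
      have hwi : w i = x i := by simp [hw, his]
      have hwc : w ∈ cube d := by
        rw [mem_cube] at hzc hx ⊢
        intro l
        by_cases hl : l ∈ s
        · simpa [hw, hl] using hzc l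
        · simpa [hw, hl] using hx l
      have hsub : uIcc (x i) (z i) ⊆ Icc (0 : ℝ) 1 :=
        ordConnected_Icc.uIcc_subset (mem_cube.1 hx i) (mem_cube.1 hzc i)
      have hmv := Convex.norm_image_sub_le_of_norm_hasDerivWithin_le (𝕜 := ℝ)
        (f := fun r => f (update w i r) - pd d i f x * r)
        (f' := fun r => pd d i f (update w i r) - pd d i f x) (s := uIcc (x i) (z i))
        (x := x i) (y := z i) (C := ε)
        (by
          intro r hr
          have h1 := (hf.hasDerivWithinAt_update hwc i (hsub hr)).mono hsub
          have h2 := (hasDerivWithinAt_id r (uIcc (x i) (z i))).const_mul (pd d i f x)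
          simpa using h1.fun_sub h2)
        (by
          intro r hr
          refine (hδs ⟨?_, update_mem_cube hwc i (hsub hr)⟩ i).le
          rw [Metric.mem_ball, dist_pi_lt_iff hδ]
          intro l
          rcases eq_or_ne l i with rfl | hl
          · rw [update_self, Real.dist_eq]
            exact (abs_sub_left_of_mem_uIcc hr).trans_lt (hzi l)
          · rw [update_of_ne hl, Real.dist_eq]
            by_cases hls : l ∈ s
            · simpa [hw, hls] using hzi l
            · simpa [hw, hls] using hδ)
        (convex_uIcc _ _) left_mem_uIcc right_mem_uIcc
      rw [Real.norm_eq_abs, Real.norm_eq_abs] at hmv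
      have hux : update w i (x i) = w := by rw [← hwi, update_eq_self]
      simp only [hux] at hmv
      calc _ = |(f (update w i (z i)) - pd d i f x * z i - (f w - pd d i f x * x i)) +
            (f w - f x - ∑ i ∈ s, pd d i f x * (z i - x i))| := by congr 1; ring
        _ ≤ _ := (abs_add_le _ _).trans (add_le_add hmv ih)
  have hfin := key Finset.univ
  rw [Finset.piecewise_univ] at hfin
  rw [cubeGrad_apply, Real.norm_eq_abs]
  simp only [Pi.sub_apply]
  refine hfin.trans ?_
  calc ∑ i, ε * |z i - x i| ≤ ∑ _i : Fin d, ε * ‖z - x‖ := by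
        gcongr with i
        exact norm_le_pi_norm (z - x) i
    _ = (d * ε) * ‖z - x‖ := by simp; ring
    _ ≤ c * ‖z - x‖ := by
        gcongr
        rw [hε, mul_div_assoc', div_le_iff₀ (by positivity)]
        nlinarith

lemma MemCm.pd_comm {d : ℕ} {f : (Fin d → ℝ) → ℝ} (hf : MemCm d 2 f) (l m : Fin d)
    {x : Fin d → ℝ} (hx : x ∈ cube d) :
    pd d m (pd d l f) x = pd d l (pd d m f) x := by
  have hne : (interior (cube d)).Nonempty :=
    ⟨fun _ => 1 / 2, mem_interior_cube.2 fun _ => by norm_num⟩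
  have h1 : ∀ z ∈ interior (cube d), HasFDerivAt f (cubeGrad d f z) z := fun z hz =>
    (hf.of_succ.hasFDerivWithinAt (interior_subset hz)).hasFDerivAt
      (mem_interior_iff_mem_nhds.1 hz)
  have h2 : HasFDerivWithinAt (cubeGrad d f)
      (∑ i, (cubeGrad d (pd d i f) x).smulRight
        (ContinuousLinearMap.proj (R := ℝ) (φ := fun _ : Fin d => ℝ) i)) (interior (cube d)) x := by
    refine HasFDerivWithinAt.fun_sum fun i _ => ?_
    exact (((hf.memCm_pd i).hasFDerivWithinAt hx).mono interior_subset).smul_const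
      (ContinuousLinearMap.proj (R := ℝ) (φ := fun _ : Fin d => ℝ) i)
  have := (convex_cube d).second_derivative_within_at_symmetric hne h1 hx h2
    (Pi.single m 1) (Pi.single l 1)
  simpa [cubeGrad_apply, Pi.single_apply] using this

lemma foldr_pd_eq_self {d : ℕ} {α : Fin d → ℕ} {L : List (Fin d)} (h : ∀ i ∈ L, α i = 0)
    (f : (Fin d → ℝ) → ℝ) : L.foldr (fun i g => (pd d i)^[α i] g) f = f := by
  induction L with
  | nil => rfl
  | cons a L ih =>
    rw [List.foldr_cons, ih fun i hi => h i (List.mem_cons_of_mem _ hi),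
      h a List.mem_cons_self, iterate_zero, id]

lemma foldr_pd_eq_pd {d : ℕ} {α : Fin d → ℕ} {L : List (Fin d)} (hL : L.Nodup) {l : Fin d}
    (hl : l ∈ L) (hαl : α l = 1) (hα : ∀ i ≠ l, α i = 0) (f : (Fin d → ℝ) → ℝ) :
    L.foldr (fun i g => (pd d i)^[α i] g) f = pd d l f := by
  induction L with
  | nil => simp at hl
  | cons a L ih =>
    obtain ⟨haL, hL⟩ := List.nodup_cons.1 hL
    rw [List.foldr_cons]
    rcases eq_or_ne a l with rfl | hal
    · rw [foldr_pd_eq_self fun i hi => hα i (ne_of_mem_of_not_mem hi haL), hαl, iterate_one]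
    · rw [ih hL ((List.mem_cons.1 hl).resolve_left hal.symm), hα a hal, iterate_zero, id]

lemma foldr_pd_eq_pd_pd {d : ℕ} {L : List (Fin d)} (hL : L.Nodup) {l m : Fin d}
    (hl : l ∈ L) (hm : m ∈ L) (f : (Fin d → ℝ) → ℝ) :
    L.foldr (fun i g => (pd d i)^[(Pi.single l 1 + Pi.single m 1 : Fin d → ℕ) i] g) f
        = pd d l (pd d m f) ∨
      L.foldr (fun i g => (pd d i)^[(Pi.single l 1 + Pi.single m 1 : Fin d → ℕ) i] g) f
        = pd d m (pd d l f) := by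
  induction L with
  | nil => simp at hl
  | cons a L ih =>
    obtain ⟨haL, hL⟩ := List.nodup_cons.1 hL
    have hsingle : ∀ {n : Fin d}, n ∈ L →
        L.foldr (fun i g => (pd d i)^[(Pi.single a 1 + Pi.single n 1 : Fin d → ℕ) i] g) f
          = pd d n f := by
      intro n hn
      rw [← foldr_pd_eq_pd (α := Pi.single n 1) hL hn (by simp)
        (fun i hi => by simp [hi]) f]
      refine List.foldr_ext _ _ _ fun i hi g => ?_
      simp [ne_of_mem_of_not_mem hi haL]
    rw [List.foldr_cons]
    rcases eq_or_ne a l with rfl | hal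
    · left
      rcases eq_or_ne m a with rfl | hma
      · rw [foldr_pd_eq_self fun i hi => by simp [ne_of_mem_of_not_mem hi haL]]
        simp
      · rw [hsingle ((List.mem_cons.1 hm).resolve_left hma)]
        simp [hma.symm]
    · rcases eq_or_ne a m with rfl | ham
      · right
        rw [add_comm, hsingle ((List.mem_cons.1 hl).resolve_left hal.symm)]
        simp [hal]
      · have := ih hL ((List.mem_cons.1 hl).resolve_left hal.symm)
          ((List.mem_cons.1 hm).resolve_left ham.symm)
        simpa [hal, ham] using this

lemma abs_le_supCube {d : ℕ} {g : (Fin d → ℝ) → ℝ} (hg : ContinuousOn g (cube d))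
    {x : Fin d → ℝ} (hx : x ∈ cube d) : |g x| ≤ supCube d g := by
  have hbdd : BddAbove (range fun z : cube d => |g z.1|) := by
    have := (isCompact_cube d).bddAbove_image hg.abs
    rwa [image_eq_range] at this
  exact le_ciSup hbdd ⟨x, hx⟩

lemma sum_supCube_mderiv_le_lamNorm {d m : ℕ} (b : Fin d → (Fin d → ℝ) → ℝ) {α : Fin d → ℕ}
    (h0 : 0 < ∑ i, α i) (hm : ∑ i, α i ≤ m) :
    ∑ i, supCube d (mderiv d α (b i)) ≤ lamNorm d m b := by
  have hfin : Finite {α : Fin d → ℕ // 0 < (∑ i, α i) ∧ (∑ i, α i) ≤ m} := by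
    refine Set.Finite.subset (Set.finite_Icc 0 fun _ => m) fun β hβ => ⟨zero_le, fun i => ?_⟩
    exact (Finset.single_le_sum (f := β) (fun _ _ => Nat.zero_le _) (Finset.mem_univ i)).trans hβ.2
  exact le_ciSup (f := fun α : {α : Fin d → ℕ // 0 < (∑ i, α i) ∧ (∑ i, α i) ≤ m} =>
    ∑ i, supCube d (mderiv d α.1 (b i))) (Set.finite_range _).bddAbove ⟨α, h0, hm⟩

lemma sum_abs_pd_le_lamNorm {d : ℕ} {b : Fin d → (Fin d → ℝ) → ℝ}
    (hb : ∀ i, MemCm d 1 (b i)) (l : Fin d) {x : Fin d → ℝ} (hx : x ∈ cube d) :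
    ∑ i, |pd d l (b i) x| ≤ lamNorm d 2 b := by
  refine le_trans (Finset.sum_le_sum fun i _ => ?_)
    (sum_supCube_mderiv_le_lamNorm b (α := Pi.single l 1) (by simp) (by simp))
  rw [mderiv, foldr_pd_eq_pd (List.nodup_finRange d) (List.mem_finRange l) (by simp)
    (fun i hi => by simp [hi])]
  exact abs_le_supCube ((hb i).memCm_pd l).continuousOn hx

lemma sum_abs_pd_pd_le_lamNorm {d : ℕ} {b : Fin d → (Fin d → ℝ) → ℝ}
    (hb : ∀ i, MemCm d 2 (b i)) (l m : Fin d) {x : Fin d → ℝ} (hx : x ∈ cube d) :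
    ∑ i, |pd d m (pd d l (b i)) x| ≤ lamNorm d 2 b := by
  refine le_trans (Finset.sum_le_sum fun i _ => ?_)
    (sum_supCube_mderiv_le_lamNorm b (α := Pi.single l 1 + Pi.single m 1)
      (by simp [Finset.sum_add_distrib]) (by simp [Finset.sum_add_distrib]))
  rcases foldr_pd_eq_pd_pd (List.nodup_finRange d) (List.mem_finRange l) (List.mem_finRange m)
    (b i) with h | h
  · rw [mderiv, h, (hb i).pd_comm l m hx]
    exact abs_le_supCube (((hb i).memCm_pd m).memCm_pd l).continuousOn hx
  · rw [mderiv, h]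
    exact abs_le_supCube (((hb i).memCm_pd l).memCm_pd m).continuousOn hx

lemma ordConnected_setOf_intervalIntegrable (f : ℝ → ℝ) (a : ℝ) :
    OrdConnected {t | IntervalIntegrable f volume a t} := by
  refine ⟨fun s hs t ht r hr => ?_⟩
  rw [mem_ofPred_eq] at *
  rcases le_total a r with h | h
  · exact ht.mono_set (by rw [uIcc_of_le h, uIcc_of_le (h.trans hr.2)]; gcongr; exact hr.2)
  · exact hs.mono_set (by rw [uIcc_of_ge h, uIcc_of_ge (hr.1.trans h)]; gcongr; exact hr.1)

lemma aestronglyMeasurable_primitive (f : ℝ → ℝ) :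
    AEStronglyMeasurable (fun t => ∫ s in (0 : ℝ)..t, f s) (volume.restrict (Ici 0)) := by
  set S : Set ℝ := {t | IntervalIntegrable f volume 0 t} ∩ Ici 0 with hS
  have hSm : MeasurableSet S :=
    ((ordConnected_setOf_intervalIntegrable f 0).inter ordConnected_Ici).measurableSet
  have hcont : ContinuousOn (fun t => ∫ s in (0 : ℝ)..t, f s) S := by
    intro t ht
    have hIcc : ∀ u ∈ S, ContinuousOn (fun t => ∫ s in (0 : ℝ)..t, f s) (Icc 0 u) := by
      intro u hu
      rw [← uIcc_of_le (show (0 : ℝ) ≤ u from hu.2)]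
      exact intervalIntegral.continuousOn_primitive_interval' hu.1 left_mem_uIcc
    by_cases h : ∃ u ∈ S, t < u
    · obtain ⟨u, hu, htu⟩ := h
      refine (hIcc u hu t ⟨ht.2, htu.le⟩).mono_of_mem_nhdsWithin ?_
      filter_upwards [self_mem_nhdsWithin, mem_nhdsWithin_of_mem_nhds (Iio_mem_nhds htu)]
        with r hr hru
      exact ⟨hr.2, le_of_lt hru⟩
    · push Not at h
      exact (hIcc t ht t ⟨ht.2, le_rfl⟩).mono fun r hr => ⟨hr.2, h r hr⟩
  have h1 : AEStronglyMeasurable (S.indicator fun t => ∫ s in (0 : ℝ)..t, f s) volume :=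
    (aestronglyMeasurable_indicator_iff hSm).2 (hcont.aestronglyMeasurable hSm)
  refine h1.restrict.congr ?_
  filter_upwards [ae_restrict_mem measurableSet_Ici] with t ht
  by_cases hts : t ∈ S
  · rw [indicator_of_mem hts]
  · rw [indicator_of_notMem hts, intervalIntegral.integral_undef fun h => hts ⟨h, ht⟩]

/-- The Grönwall inequality in the `ℓ¹`-norm with a time-dependent inhomogeneity. -/
lemma sum_abs_le_of_integral_eq {d : ℕ} {v g : Fin d → ℝ → ℝ} {c : Fin d → ℝ}
    (hg : ∀ i, ContinuousOn (g i) (Ici 0))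
    (hv : ∀ i, ∀ t, 0 ≤ t → v i t = c i + ∫ s in (0 : ℝ)..t, g i s)
    {lam : ℝ} {h B : ℝ → ℝ} (hgb : ∀ t, 0 ≤ t → ∑ i, |g i t| ≤ lam * ∑ i, |v i t| + h t)
    (hB : ∀ t, HasDerivAt B (lam * B t + h t) t) (h0 : ∑ i, |c i| ≤ B 0) {t : ℝ} (ht : 0 ≤ t) :
    ∑ i, |v i t| ≤ B t := by
  have hint : ∀ i, ∀ s, 0 ≤ s → IntervalIntegrable (g i) volume 0 s := fun i s hs =>
    ((hg i).mono (by rw [uIcc_of_le hs]; exact Icc_subset_Ici_self)).intervalIntegrable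
  have hderiv : ∀ i, ∀ s, 0 ≤ s → HasDerivWithinAt (v i) (g i s) (Ici s) s := by
    intro i s hs
    have hc : ContinuousWithinAt (g i) (Ici s) s :=
      ((hg i) s hs).mono (Ici_subset_Ici.2 hs)
    have hm : StronglyMeasurableAtFilter (g i) (𝓝[Ioi s] s) volume :=
      ⟨Ioi s, self_mem_nhdsWithin, ((hg i).mono fun r hr =>
        hs.trans (le_of_lt hr)).aestronglyMeasurable measurableSet_Ioi⟩
    have := (intervalIntegral.integral_hasDerivWithinAt_right (hint i s hs) (s := Ici s)
      (t := Ioi s) hm (hc.mono Ioi_subset_Ici_self)).const_add (c i)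
    exact this.congr (fun r hr => hv i r (hs.trans hr)) (hv i s hs)
  have hcont : ∀ i, ContinuousOn (v i) (Icc 0 t) := by
    intro i
    have := intervalIntegral.continuousOn_primitive_interval' (hint i t ht) left_mem_uIcc
    rw [uIcc_of_le ht] at this
    exact (this.const_add (c i)).congr fun r hr => hv i r hr.1
  refine le_of_forall_pos_le_add fun ε hε => ?_
  have hE : ∀ s, HasDerivAt (fun s => B s + ε * Real.exp (-(lam + 1) * t) * Real.exp ((lam + 1) * s))
      (lam * B s + h s + ε * Real.exp (-(lam + 1) * t) *
        (Real.exp ((lam + 1) * s) * (lam + 1))) s := by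
    intro s
    have h1 : HasDerivAt (fun s => (lam + 1) * s) (lam + 1) s := by
      simpa using (hasDerivAt_id s).const_mul (lam + 1)
    exact (hB s).fun_add (h1.exp.const_mul _)
  have hmain := image_norm_le_of_norm_deriv_right_lt_deriv_boundary' (a := 0) (b := t)
    (f := fun s => (WithLp.toLp 1 fun i => v i s : PiLp 1 fun _ : Fin d => ℝ))
    (f' := fun s => (WithLp.toLp 1 fun i => g i s : PiLp 1 fun _ : Fin d => ℝ))
    (by
      have : ContinuousOn (fun s i => v i s) (Icc 0 t) := continuousOn_pi.2 hcont
      exact (PiLp.continuous_toLp 1 _).comp_continuousOn this)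
    (by
      intro s hs
      rw [hasDerivWithinAt_iff_hasFDerivWithinAt, hasFDerivWithinAt_piLp]
      intro i
      exact (hderiv i s hs.1).hasFDerivWithinAt.congr_fderiv (by ext; simp))
    (B := fun s => B s + ε * Real.exp (-(lam + 1) * t) * Real.exp ((lam + 1) * s))
    (by
      rw [PiLp.norm_eq_of_L1]
      have : ∀ i, v i 0 = c i := fun i => by simpa using hv i 0 le_rfl
      simp only [this, Real.norm_eq_abs]
      exact h0.trans (le_add_of_nonneg_right (by positivity)))
    (fun s _ => (hE s).continuousAt.continuousWithinAt)
    (fun s _ => (hE s).hasDerivWithinAt)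
    (by
      intro s hs heq
      rw [PiLp.norm_eq_of_L1] at heq ⊢
      simp only [Real.norm_eq_abs] at heq ⊢
      have h1 := hgb s hs.1
      rw [heq] at h1
      have h2 : 0 < ε * Real.exp (-(lam + 1) * t) * Real.exp ((lam + 1) * s) := by positivity
      linarith)
    (right_mem_Icc.2 ht)
  rw [PiLp.norm_eq_of_L1] at hmain
  have hexp : Real.exp (-(lam + 1) * t) * Real.exp ((lam + 1) * t) = 1 := by
    rw [← Real.exp_add, ← Real.exp_zero]
    ring_nf
  rw [mul_assoc, hexp, mul_one] at hmain
  simpa using hmain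

lemma pd_eq_of_integral_eq {d : ℕ} {t : ℝ} (ht : 0 ≤ t) {W c : (Fin d → ℝ) → ℝ} {c' : ℝ}
    {G G' : ℝ → (Fin d → ℝ) → ℝ} {k : Fin d} {x : Fin d → ℝ} (hx : x ∈ interior (cube d))
    (hW : ∀ z ∈ interior (cube d), W z = c z + ∫ s in (0 : ℝ)..t, G s z)
    (hc : HasDerivAt (fun r => c (update x k r)) c' (x k))
    (hG : ContinuousOn (fun q : ℝ × (Fin d → ℝ) => G q.1 q.2) (Ici (0 : ℝ) ×ˢ cube d))
    (hG' : ContinuousOn (fun q : ℝ × (Fin d → ℝ) => G' q.1 q.2) (Ici (0 : ℝ) ×ˢ cube d))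
    (hGG' : ∀ s, 0 ≤ s → ∀ r ∈ Ioo (0 : ℝ) 1,
      HasDerivAt (fun r => G s (update x k r)) (G' s (update x k r)) r) :
    pd d k W x = c' + ∫ s in (0 : ℝ)..t, G' s x := by
  have hxk : x k ∈ Ioo (0 : ℝ) 1 := mem_interior_cube.1 hx k
  have hslice : ∀ {H : ℝ → (Fin d → ℝ) → ℝ},
      ContinuousOn (fun q : ℝ × (Fin d → ℝ) => H q.1 q.2) (Ici (0 : ℝ) ×ˢ cube d) →
      ∀ z ∈ cube d, ContinuousOn (fun s => H s z) (Icc 0 t) := by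
    intro H hH z hz
    exact hH.comp (f := fun s => (s, z)) (by fun_prop) fun s hs => ⟨hs.1, hz⟩
  have hmeas : ∀ {H : ℝ → (Fin d → ℝ) → ℝ},
      ContinuousOn (fun q : ℝ × (Fin d → ℝ) => H q.1 q.2) (Ici (0 : ℝ) ×ˢ cube d) →
      ∀ z ∈ cube d, AEStronglyMeasurable (fun s => H s z) (volume.restrict (uIoc 0 t)) := by
    intro H hH z hz
    rw [uIoc_of_le ht]
    exact ((hslice hH z hz).mono Ioc_subset_Icc_self).aestronglyMeasurable measurableSet_Ioc
  obtain ⟨C, hC⟩ := ((isCompact_Icc (a := (0 : ℝ)) (b := t)).prod (isCompact_cube d)).exists_bound_of_continuousOn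
    (hG'.mono (prod_mono Icc_subset_Ici_self Subset.rfl))
  have hnhds : Ioo (0 : ℝ) 1 ∈ 𝓝 (x k) := Ioo_mem_nhds hxk.1 hxk.2
  have hup : ∀ r ∈ Ioo (0 : ℝ) 1, update x k r ∈ cube d := fun r hr =>
    interior_subset (update_mem_interior_cube hx k hr)
  have hI := (intervalIntegral.hasDerivAt_integral_of_dominated_loc_of_deriv_le (μ := volume)
    (a := 0) (b := t) (F := fun r s => G s (update x k r)) (F' := fun r s => G' s (update x k r))
    (bound := fun _ => C) hnhds
    (by filter_upwards [hnhds] with r hr using hmeas hG _ (hup r hr))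
    (ContinuousOn.intervalIntegrable (by
      rw [uIcc_of_le ht]; exact hslice hG _ (hup _ hxk)))
    (hmeas hG' _ (hup _ hxk))
    (by
      refine Eventually.of_forall fun s hs r hr => ?_
      rw [uIoc_of_le ht] at hs
      exact hC (s, update x k r) ⟨Ioc_subset_Icc_self hs, hup r hr⟩)
    intervalIntegrable_const
    (by
      refine Eventually.of_forall fun s hs r hr => ?_
      rw [uIoc_of_le ht] at hs
      exact hGG' s hs.1.le r hr)).2
  have hD : HasDerivAt (fun r => W (update x k r)) (c' + ∫ s in (0 : ℝ)..t, G' s x) (x k) := by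
    have := hc.fun_add hI
    simp only [update_eq_self] at this
    refine this.congr_of_eventuallyEq ?_
    filter_upwards [hnhds] with r hr using hW _ (update_mem_interior_cube hx k hr)
  exact hD.hasDerivWithinAt.derivWithin (uniqueDiffOn_Icc zero_lt_one _ ⟨hxk.1.le, hxk.2.le⟩)

lemma MemCm.hasDerivAt_comp_update {d : ℕ} {g : (Fin d → ℝ) → ℝ} (hg : MemCm d 1 g)
    {Y : (Fin d → ℝ) → (Fin d → ℝ)} (hY : ∀ l, MemCm d 1 fun z => Y z l)
    (hYc : MapsTo Y (cube d) (cube d)) {x : Fin d → ℝ} (hx : x ∈ cube d) (k : Fin d) {r : ℝ}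
    (hr : r ∈ Ioo (0 : ℝ) 1) :
    HasDerivAt (fun r => g (Y (update x k r)))
      (∑ l, pd d l g (Y (update x k r)) * pd d k (fun z => Y z l) (update x k r)) r := by
  have hr' := Ioo_subset_Icc_self hr
  have h1 : HasDerivAt (fun r => Y (update x k r))
      (fun l => pd d k (fun z => Y z l) (update x k r)) r := hasDerivAt_pi.2 fun l =>
    ((hY l).hasDerivWithinAt_update hx k hr').hasDerivAt (Icc_mem_nhds hr.1 hr.2)
  have h2 := (hg.hasFDerivWithinAt (hYc (update_mem_cube hx k hr'))).comp_hasDerivAt r h1 (by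
    filter_upwards [Icc_mem_nhds hr.1 hr.2] with u hu using hYc (update_mem_cube hx k hu))
  rwa [cubeGrad_apply] at h2

/-- A flow on the cube generated by a `C³` drift, spatially `C²` with spatial derivatives jointly
continuous in time and space. -/
structure IsRegularFlow (d : ℕ) (b : Fin d → (Fin d → ℝ) → ℝ)
    (y : ℝ → (Fin d → ℝ) → (Fin d → ℝ)) : Prop where
  memCm_drift : ∀ i, MemCm d 3 (b i)
  mapsTo : ∀ t, 0 ≤ t → MapsTo (y t) (cube d) (cube d)
  integral_eq : ∀ i, ∀ t, 0 ≤ t → ∀ x ∈ cube d, y t x i = x i + ∫ s in (0 : ℝ)..t, b i (y s x)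
  memCm : ∀ t, 0 ≤ t → ∀ i, MemCm d 2 fun x => y t x i
  continuousOn_pd : ∀ i j, ContinuousOn
    (fun q : ℝ × (Fin d → ℝ) => pd d j (fun x => y q.1 x i) q.2) (Ici (0 : ℝ) ×ˢ cube d)
  continuousOn_pd_pd : ∀ i j k, ContinuousOn
    (fun q : ℝ × (Fin d → ℝ) => pd d k (pd d j (fun x => y q.1 x i)) q.2) (Ici (0 : ℝ) ×ˢ cube d)

namespace IsRegularFlow

variable {d : ℕ} {b : Fin d → (Fin d → ℝ) → ℝ} {y : ℝ → (Fin d → ℝ) → (Fin d → ℝ)}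

lemma integrableOn_drift (h : IsRegularFlow d b y) {x : Fin d → ℝ} (hx : x ∈ cube d) (i : Fin d)
    (t : ℝ) : IntegrableOn (fun s => b i (y s x)) (Icc 0 t) := by
  have hbc := (h.memCm_drift i).continuousOn
  have hy : AEMeasurable (fun s => y s x) (volume.restrict (Ici 0)) := by
    refine aemeasurable_pi_iff.2 fun l => ?_
    refine ((aestronglyMeasurable_primitive fun s => b l (y s x)).aemeasurable.const_add
      (x l)).congr ?_
    filter_upwards [ae_restrict_mem measurableSet_Ici] with s hs
    exact (h.integral_eq l s hs x hx).symm
  classical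
  have hmeas : AEMeasurable (fun s => b i (y s x)) (volume.restrict (Ici 0)) := by
    have hind : Measurable ((cube d).piecewise (b i) fun _ => 0) :=
      hbc.measurable_piecewise continuousOn_const (isCompact_cube d).measurableSet
    refine (hind.comp_aemeasurable hy).congr ?_
    filter_upwards [ae_restrict_mem measurableSet_Ici] with s hs
    exact piecewise_eq_of_mem _ _ _ (h.mapsTo s hs hx)
  obtain ⟨C, hC⟩ := (isCompact_cube d).exists_bound_of_continuousOn hbc
  refine IntegrableOn.of_bound (C := C) (by simp)
    (hmeas.mono_measure (Measure.restrict_mono_set _ Icc_subset_Ici_self)).aestronglyMeasurable ?_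
  filter_upwards [ae_restrict_mem measurableSet_Icc] with s hs
  exact hC _ (h.mapsTo s hs.1 hx)

lemma continuousOn (h : IsRegularFlow d b y) :
    ContinuousOn (fun q : ℝ × (Fin d → ℝ) => y q.1 q.2) (Ici (0 : ℝ) ×ˢ cube d) := by
  have hbdd : ∀ i, ∃ C, ∀ x ∈ cube d, ‖b i x‖ ≤ C := fun i =>
    (isCompact_cube d).exists_bound_of_continuousOn (h.memCm_drift i).continuousOn
  choose C hC using hbdd
  refine continuousOn_pi.2 fun i => ?_
  refine continuousOn_prod_of_continuousOn_lipschitzOnWith _ (C i).toNNReal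
    (fun s hs => (h.memCm s hs i).continuousOn) fun x hx => ?_
  have hint : ∀ r : ℝ, 0 ≤ r → IntervalIntegrable (fun s => b i (y s x)) volume 0 r := fun r hr =>
    (intervalIntegrable_iff_integrableOn_Icc_of_le hr).2 (h.integrableOn_drift hx i r)
  refine LipschitzOnWith.of_dist_le_mul fun s hs r hr => ?_
  rw [h.integral_eq i s hs x hx, h.integral_eq i r hr x hx, dist_add_left, Real.dist_eq,
    intervalIntegral.integral_interval_sub_left (hint s hs) (hint r hr), Real.dist_eq]
  refine (intervalIntegral.norm_integral_le_of_norm_le_const (C := C i)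
    (f := fun s => b i (y s x)) fun u hu => ?_).trans ?_
  · have h0 : 0 ≤ u := (le_min hr hs).trans (uIoc_subset_uIcc hu).1
    exact hC i _ (h.mapsTo u h0 hx)
  · gcongr
    exact Real.le_coe_toNNReal _

lemma continuousOn_comp (h : IsRegularFlow d b y) {g : (Fin d → ℝ) → ℝ}
    (hg : ContinuousOn g (cube d)) :
    ContinuousOn (fun q : ℝ × (Fin d → ℝ) => g (y q.1 q.2)) (Ici (0 : ℝ) ×ˢ cube d) :=
  hg.comp h.continuousOn fun q hq => h.mapsTo q.1 hq.1 hq.2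

lemma hasDerivAt_comp (h : IsRegularFlow d b y) {g : (Fin d → ℝ) → ℝ} (hg : MemCm d 1 g)
    {x : Fin d → ℝ} (hx : x ∈ cube d) (k : Fin d) {s : ℝ} (hs : 0 ≤ s) {r : ℝ}
    (hr : r ∈ Ioo (0 : ℝ) 1) :
    HasDerivAt (fun r => g (y s (update x k r)))
      (∑ l, pd d l g (y s (update x k r)) * pd d k (fun z => y s z l) (update x k r)) r :=
  hg.hasDerivAt_comp_update (fun l => (h.memCm s hs l).of_succ) (h.mapsTo s hs) hx k hr

lemma continuousOn_variation (h : IsRegularFlow d b y) (i j : Fin d) :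
    ContinuousOn (fun q : ℝ × (Fin d → ℝ) =>
      ∑ l, pd d l (b i) (y q.1 q.2) * pd d j (fun z => y q.1 z l) q.2)
      (Ici (0 : ℝ) ×ˢ cube d) :=
  continuousOn_finsetSum _ fun l _ =>
    (h.continuousOn_comp ((h.memCm_drift i).memCm_pd l).continuousOn).mul (h.continuousOn_pd l j)

lemma continuousOn_second_variation (h : IsRegularFlow d b y) (i j k : Fin d) :
    ContinuousOn (fun q : ℝ × (Fin d → ℝ) =>
      ∑ l, ((∑ m, pd d m (pd d l (b i)) (y q.1 q.2) * pd d k (fun z => y q.1 z m) q.2) *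
          pd d j (fun z => y q.1 z l) q.2 +
        pd d l (b i) (y q.1 q.2) * pd d k (pd d j fun z => y q.1 z l) q.2))
      (Ici (0 : ℝ) ×ˢ cube d) := by
  refine continuousOn_finsetSum _ fun l _ => ContinuousOn.add (ContinuousOn.mul
    (continuousOn_finsetSum _ fun m _ => ?_) (h.continuousOn_pd l j)) ?_
  · exact (h.continuousOn_comp (((h.memCm_drift i).memCm_pd l).memCm_pd m).continuousOn).mul
      (h.continuousOn_pd m k)
  · exact (h.continuousOn_comp ((h.memCm_drift i).memCm_pd l).continuousOn).mul
      (h.continuousOn_pd_pd l j k)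

lemma continuousOn_slice {H : ℝ × (Fin d → ℝ) → ℝ} (hH : ContinuousOn H (Ici (0 : ℝ) ×ˢ cube d))
    {x : Fin d → ℝ} (hx : x ∈ cube d) : ContinuousOn (fun s => H (s, x)) (Ici 0) :=
  hH.comp (by fun_prop) fun _ hs => ⟨hs, hx⟩

/-- The first variational equation. -/
lemma pd_eq (h : IsRegularFlow d b y) (i j : Fin d) {t : ℝ} (ht : 0 ≤ t) {x : Fin d → ℝ}
    (hx : x ∈ interior (cube d)) :
    pd d j (fun z => y t z i) x = (Pi.single j 1 : Fin d → ℝ) i +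
      ∫ s in (0 : ℝ)..t, ∑ l, pd d l (b i) (y s x) * pd d j (fun z => y s z l) x :=
  pd_eq_of_integral_eq (c := fun z => z i) (G := fun s z => b i (y s z))
    (G' := fun s z => ∑ l, pd d l (b i) (y s z) * pd d j (fun z => y s z l) z) ht hx
    (fun z hz => h.integral_eq i t ht z (interior_subset hz))
    (hasDerivAt_pi.1 (hasDerivAt_update x j (x j)) i)
    (h.continuousOn_comp (h.memCm_drift i).continuousOn) (h.continuousOn_variation i j)
    (fun _ hs _ hr => h.hasDerivAt_comp (h.memCm_drift i).of_succ.of_succ (interior_subset hx) j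
      hs hr)

/-- The second variational equation. -/
lemma pd_pd_eq (h : IsRegularFlow d b y) (i j k : Fin d) {t : ℝ} (ht : 0 ≤ t) {x : Fin d → ℝ}
    (hx : x ∈ interior (cube d)) :
    pd d k (pd d j fun z => y t z i) x = 0 + ∫ s in (0 : ℝ)..t,
      ∑ l, ((∑ m, pd d m (pd d l (b i)) (y s x) * pd d k (fun z => y s z m) x) *
          pd d j (fun z => y s z l) x +
        pd d l (b i) (y s x) * pd d k (pd d j fun z => y s z l) x) :=
  pd_eq_of_integral_eq (c := fun _ => (Pi.single j 1 : Fin d → ℝ) i)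
    (G := fun s z => ∑ l, pd d l (b i) (y s z) * pd d j (fun z => y s z l) z)
    (G' := fun s x =>
      ∑ l, ((∑ m, pd d m (pd d l (b i)) (y s x) * pd d k (fun z => y s z m) x) *
          pd d j (fun z => y s z l) x +
        pd d l (b i) (y s x) * pd d k (pd d j fun z => y s z l) x)) ht hx
    (fun _ hz => h.pd_eq i j ht hz) (hasDerivAt_const _ _)
    (h.continuousOn_variation i j) (h.continuousOn_second_variation i j k)
    (fun s hs _ hr => HasDerivAt.fun_sum fun l _ =>
      (h.hasDerivAt_comp ((h.memCm_drift i).memCm_pd l).of_succ (interior_subset hx) k hs hr).mul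
        ((((h.memCm s hs l).memCm_pd j).hasDerivWithinAt_update (interior_subset hx) k
          (Ioo_subset_Icc_self hr)).hasDerivAt (Icc_mem_nhds hr.1 hr.2)))

lemma lamNorm_nonneg (h : IsRegularFlow d b y) (j : Fin d) : 0 ≤ lamNorm d 2 b :=
  (Finset.sum_nonneg fun _ _ => abs_nonneg _).trans
    (sum_abs_pd_le_lamNorm (fun i => (h.memCm_drift i).of_succ.of_succ) j
      (x := fun _ => 0) (mem_cube.2 fun _ => by simp))

end IsRegularFlow

lemma sum_abs_sum_mul_le {d : ℕ} {A : Fin d → Fin d → ℝ} {v : Fin d → ℝ} {K : ℝ}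
    (hA : ∀ l, ∑ i, |A i l| ≤ K) : ∑ i, |∑ l, A i l * v l| ≤ K * ∑ l, |v l| :=
  calc ∑ i, |∑ l, A i l * v l| ≤ ∑ i, ∑ l, |A i l| * |v l| := by
        gcongr with i
        exact (Finset.abs_sum_le_sum_abs _ _).trans_eq (by simp only [abs_mul])
    _ = ∑ l, (∑ i, |A i l|) * |v l| := by
        rw [Finset.sum_comm]; simp only [Finset.sum_mul]
    _ ≤ ∑ l, K * |v l| := by gcongr with l; exact hA l
    _ = K * ∑ l, |v l| := by rw [Finset.mul_sum]

namespace IsRegularFlow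

variable {d : ℕ} {b : Fin d → (Fin d → ℝ) → ℝ} {y : ℝ → (Fin d → ℝ) → (Fin d → ℝ)}

lemma sum_abs_pd_le (h : IsRegularFlow d b y) (j : Fin d) {t : ℝ} (ht : 0 ≤ t) {x : Fin d → ℝ}
    (hx : x ∈ interior (cube d)) :
    ∑ i, |pd d j (fun z => y t z i) x| ≤ Real.exp (lamNorm d 2 b * t) := by
  refine sum_abs_le_of_integral_eq (v := fun i t => pd d j (fun z => y t z i) x)
    (g := fun i s => ∑ l, pd d l (b i) (y s x) * pd d j (fun z => y s z l) x)
    (c := Pi.single j 1) (lam := lamNorm d 2 b) (h := fun _ => 0)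
    (B := fun t => Real.exp (lamNorm d 2 b * t))
    (fun i => continuousOn_slice (h.continuousOn_variation i j) (interior_subset hx))
    (fun i t ht => h.pd_eq i j ht hx) (fun s hs => ?_) (fun s => ?_) ?_ ht
  · rw [add_zero]
    exact sum_abs_sum_mul_le fun l => sum_abs_pd_le_lamNorm
      (fun i => (h.memCm_drift i).of_succ.of_succ) l (h.mapsTo s hs (interior_subset hx))
  · have h1 : HasDerivAt (fun s => lamNorm d 2 b * s) (lamNorm d 2 b) s := by
      simpa using (hasDerivAt_id s).const_mul (lamNorm d 2 b)
    exact h1.exp.congr_deriv (by ring)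
  · simp [Pi.single_apply, apply_ite abs]

lemma sum_abs_pd_pd_le (h : IsRegularFlow d b y) (j k : Fin d) {t : ℝ} (ht : 0 ≤ t)
    {x : Fin d → ℝ} (hx : x ∈ interior (cube d)) :
    ∑ i, |pd d k (pd d j fun z => y t z i) x| ≤
      Real.exp (lamNorm d 2 b * t) * (Real.exp (lamNorm d 2 b * t) - 1) := by
  set lam := lamNorm d 2 b
  have hlam0 : 0 ≤ lam := h.lamNorm_nonneg j
  refine sum_abs_le_of_integral_eq (v := fun i t => pd d k (pd d j fun z => y t z i) x)
    (g := fun i s =>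
      ∑ l, ((∑ m, pd d m (pd d l (b i)) (y s x) * pd d k (fun z => y s z m) x) *
          pd d j (fun z => y s z l) x +
        pd d l (b i) (y s x) * pd d k (pd d j fun z => y s z l) x))
    (c := fun _ => 0) (lam := lam) (h := fun s => lam * Real.exp (lam * s) * Real.exp (lam * s))
    (B := fun t => Real.exp (lam * t) * (Real.exp (lam * t) - 1))
    (fun i => continuousOn_slice (h.continuousOn_second_variation i j k) (interior_subset hx))
    (fun i t ht => h.pd_pd_eq i j k ht hx) (fun s hs => ?_) (fun s => ?_) (by simp) ht
  · have hyx := h.mapsTo s hs (interior_subset hx)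
    have hb2 : ∀ i, MemCm d 2 (b i) := fun i => (h.memCm_drift i).of_succ
    have hquad : ∑ i, |∑ l, (∑ m, pd d m (pd d l (b i)) (y s x) * pd d k (fun z => y s z m) x) *
        pd d j (fun z => y s z l) x| ≤ lam * Real.exp (lam * s) * Real.exp (lam * s) := by
      refine (sum_abs_sum_mul_le (K := lam * Real.exp (lam * s)) fun l => ?_).trans ?_
      · refine (sum_abs_sum_mul_le fun m => sum_abs_pd_pd_le_lamNorm hb2 l m hyx).trans ?_
        gcongr
        exact h.sum_abs_pd_le k hs hx
      · gcongr
        exact h.sum_abs_pd_le j hs hx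
    have hlin : ∑ i, |∑ l, pd d l (b i) (y s x) * pd d k (pd d j fun z => y s z l) x| ≤
        lam * ∑ l, |pd d k (pd d j fun z => y s z l) x| :=
      sum_abs_sum_mul_le fun l => sum_abs_pd_le_lamNorm (fun i => (hb2 i).of_succ) l hyx
    rw [add_comm]
    refine le_trans ?_ (add_le_add hquad hlin)
    rw [← Finset.sum_add_distrib]
    gcongr with i
    rw [Finset.sum_add_distrib]
    exact abs_add_le _ _
  · have h1 : HasDerivAt (fun s => lam * s) lam s := by
      simpa using (hasDerivAt_id s).const_mul lam
    exact (h1.exp.fun_mul (h1.exp.sub_const 1)).congr_deriv (by ring)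

end IsRegularFlow

/-- Second-order derivative estimate for the flow of the drift ODE:
`∑_{i=1}^d |∂²y_i/(∂x_k ∂x_j)(t,x)| ≤ (1/2)(e^{2λ₂ t} − 1) e^{λ₂ t}`. -/
theorem drift_flow_second_derivative_estimate
    (d : ℕ) (hd : 0 < d)
    (b : Fin d → (Fin d → ℝ) → ℝ)
    (hb : ∀ i : Fin d, MemCm d 3 (b i))
    (hbdry : ∀ i : Fin d, ∀ x ∈ cube d,
      (x i = 0 → 0 ≤ b i x) ∧ (x i = 1 → b i x ≤ 0))
    (y : ℝ → (Fin d → ℝ) → (Fin d → ℝ))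
    (hy_cube : ∀ t ∈ Set.Ici (0:ℝ), ∀ x ∈ cube d, y t x ∈ cube d)
    (hy_flow : ∀ i : Fin d, ∀ t ∈ Set.Ici (0:ℝ), ∀ x ∈ cube d,
      y t x i = x i + ∫ s in (0:ℝ)..t, b i (y s x))
    (hy_C2 : ∀ t ∈ Set.Ici (0:ℝ), ∀ i : Fin d, MemCm d 2 (fun x => y t x i))
    (hy_joint1 : ∀ i j : Fin d, ContinuousOn
      (fun q : ℝ × (Fin d → ℝ) => pd d j (fun x => y q.1 x i) q.2)
      (Set.Ici (0:ℝ) ×ˢ cube d))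
    (hy_joint2 : ∀ i j k : Fin d, ContinuousOn
      (fun q : ℝ × (Fin d → ℝ) => pd d k (pd d j (fun x => y q.1 x i)) q.2)
      (Set.Ici (0:ℝ) ×ˢ cube d))
    (j k : Fin d) (t : ℝ) (ht : 0 ≤ t) (x : Fin d → ℝ) (hx : x ∈ cube d) :
    ∑ i : Fin d, |pd d k (pd d j (fun x' => y t x' i)) x| ≤
      (1/2) * (Real.exp (2 * lamNorm d 2 b * t) - 1) * Real.exp (lamNorm d 2 b * t) := by
  have h : IsRegularFlow d b y :=
    ⟨hb, fun t ht x hx => hy_cube t ht x hx, hy_flow, hy_C2, hy_joint1, hy_joint2⟩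
  have hslice : ContinuousOn
      (fun z => ∑ i : Fin d, |pd d k (pd d j (fun x' => y t x' i)) z|) (cube d) :=
    continuousOn_finsetSum _ fun i _ =>
      (((hy_C2 t ht i).memCm_pd j).memCm_pd k).continuousOn.abs
  have hxc : x ∈ closure (interior (cube d)) := by rwa [closure_interior_cube]
  refine ContinuousWithinAt.closure_le hxc ((hslice x hx).mono interior_subset)
    continuousWithinAt_const fun z hz => (h.sum_abs_pd_pd_le j k ht hz).trans ?_
  have hexp : Real.exp (2 * lamNorm d 2 b * t) = Real.exp (lamNorm d 2 b * t) ^ 2 := by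
    rw [← Real.exp_nat_mul]
    congr 1
    push_cast
    ring
  rw [hexp]
  nlinarith [mul_nonneg (Real.exp_pos (lamNorm d 2 b * t)).le
    (sq_nonneg (Real.exp (lamNorm d 2 b * t) - 1))]

end
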